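/- arXiv:2210.10682 — 2 statements merged into one kernel-verified Lean document; each statement's English description precedes it below -/
import Mathlib

section
/- Let E ⊂ ℂ^d be compact, let ν be a probability measure on E, let w be a nonnegative, bounded, upper semicontinuous weight on E with det(G_n^{ν,w}) > 0, and let u be a continuous real-valued function on E. For t ∈ ℝ set w_t(z) := w(z) exp(−t u(z)) and f_n(t) := −(1/(2 l_n)) log det(G_n^{ν,w_t}). Then f_n is a concave function on ℝ. -/
open MeasureTheory Filter Finset
open scoped ENNReal ComplexConjugate

/-- The monomial `e_i(z) = z^{α(i)}` in `d` complex variables. -/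
noncomputable def mono (d : ℕ) (α : ℕ → Fin d → ℕ) (i : ℕ) (z : Fin d → ℂ) : ℂ :=
  ∏ k, z k ^ α i k

/-- The generalized Vandermonde determinant `det [e_i(ζ_j)]` of `m` points in `ℂ^d`. -/
noncomputable def vdm (d m : ℕ) (α : ℕ → Fin d → ℕ) (ζ : Fin m → Fin d → ℂ) : ℂ :=
  Matrix.det (Matrix.of fun i j : Fin m => mono d α (i : ℕ) (ζ j))

/-- `m_n = C(n+d,d)`, the number of multi-indices in `ℕ^d` of total degree at most `n`. -/
def mdim (d n : ℕ) : ℕ := (n + d).choose d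

/-- `l_n = ∑_{i=1}^{m_n} |α(i)|`. -/
def lsum (d n : ℕ) (α : ℕ → Fin d → ℕ) : ℕ :=
  ∑ i ∈ Finset.range (mdim d n), ∑ k, α i k

/-- The weighted Gram matrix `G_n^{ν,w} = [∫_E conj(e_i) e_j w^{2n} dν]`. -/
noncomputable def gram (d n : ℕ) (α : ℕ → Fin d → ℕ) (w : (Fin d → ℂ) → ℝ)
    (ν : Measure (Fin d → ℂ)) (E : Set (Fin d → ℂ)) :
    Matrix (Fin (mdim d n)) (Fin (mdim d n)) ℂ :=
  Matrix.of fun i j : Fin (mdim d n) =>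
    ∫ z in E, conj (mono d α (i : ℕ) z) * mono d α (j : ℕ) z * (w z : ℂ) ^ (2 * n) ∂ν

section Helpers

/-- The product of two determinants, expanded over pairs of permutations. -/
theorem det_mul_det_eq_sum {R ι : Type*} [CommRing R] [Fintype ι] [DecidableEq ι]
    (A B : Matrix ι ι R) :
    A.det * B.det = ∑ τ : Equiv.Perm ι, ∑ σ : Equiv.Perm ι,
      ((Equiv.Perm.sign τ : ℤ) : R) * (((Equiv.Perm.sign σ : ℤ) : R) *
        ∏ j, A (σ j) j * B (τ j) j) := by
  rw [Matrix.det_apply', Matrix.det_apply', Finset.sum_mul_sum, Finset.sum_comm]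
  refine Finset.sum_congr rfl fun τ _ => Finset.sum_congr rfl fun σ _ => ?_
  rw [Finset.prod_mul_distrib]
  ring

variable {X : Type*} [MeasurableSpace X]

/-- The integrand in Andréief's identity is integrable. -/
theorem integrable_det_mul_det {𝕜 ι : Type*} [RCLike 𝕜] [Fintype ι] [DecidableEq ι]
    (μ : Measure X) [SigmaFinite μ] (φ ψ : ι → X → 𝕜)
    (h : ∀ i j, Integrable (fun x => φ i x * ψ j x) μ) :
    Integrable (fun z : ι → X => (Matrix.of fun i j => φ i (z j)).det *
      (Matrix.of fun i j => ψ i (z j)).det) (Measure.pi fun _ => μ) := by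
  simp only [det_mul_det_eq_sum, Matrix.of_apply]
  refine integrable_finsetSum _ fun τ _ => integrable_finsetSum _ fun σ _ => ?_
  exact ((Integrable.fintype_prod (μ := fun _ => μ)
    (f := fun j x => φ (σ j) x * ψ (τ j) x) fun j => h _ _).const_mul _).const_mul _

/-- **Andréief's identity**. -/
theorem integral_det_mul_det {𝕜 ι : Type*} [RCLike 𝕜] [Fintype ι] [DecidableEq ι]
    (μ : Measure X) [SigmaFinite μ] (φ ψ : ι → X → 𝕜)
    (h : ∀ i j, Integrable (fun x => φ i x * ψ j x) μ) :
    ∫ z : ι → X, (Matrix.of fun i j => φ i (z j)).det *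
      (Matrix.of fun i j => ψ i (z j)).det ∂(Measure.pi fun _ => μ) =
    ((Fintype.card ι).factorial : 𝕜) * (Matrix.of fun i j => ∫ x, φ i x * ψ j x ∂μ).det := by
  have hint (σ τ : Equiv.Perm ι) : Integrable
      (fun z : ι → X => ∏ j, φ (σ j) (z j) * ψ (τ j) (z j)) (Measure.pi fun _ => μ) :=
    Integrable.fintype_prod (μ := fun _ => μ)
      (f := fun j x => φ (σ j) x * ψ (τ j) x) fun j => h _ _
  simp only [det_mul_det_eq_sum, Matrix.of_apply]
  rw [integral_finsetSum _ fun τ _ => integrable_finsetSum _ fun σ _ =>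
    ((hint σ τ).const_mul _).const_mul _]
  have key (τ : Equiv.Perm ι) : ∫ z : ι → X, ∑ σ : Equiv.Perm ι,
      ((Equiv.Perm.sign τ : ℤ) : 𝕜) * (((Equiv.Perm.sign σ : ℤ) : 𝕜) *
        ∏ j, φ (σ j) (z j) * ψ (τ j) (z j)) ∂(Measure.pi fun _ => μ) =
      (Matrix.of fun i j => ∫ x, φ i x * ψ j x ∂μ).det := by
    rw [integral_finsetSum _ fun σ _ => ((hint σ τ).const_mul _).const_mul _]
    simp only [integral_const_mul]
    rw [← Finset.mul_sum]
    set G : Matrix ι ι 𝕜 := Matrix.of fun i j => ∫ x, φ i x * ψ j x ∂μ with hG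
    have h1 : ∑ σ : Equiv.Perm ι, ((Equiv.Perm.sign σ : ℤ) : 𝕜) *
        ∫ z : ι → X, ∏ j, φ (σ j) (z j) * ψ (τ j) (z j) ∂(Measure.pi fun _ => μ) =
        (G.submatrix id τ).det := by
      rw [Matrix.det_apply']
      refine Finset.sum_congr rfl fun σ _ => ?_
      rw [integral_fintype_prod_eq_prod (μ := fun _ => μ) fun j x => φ (σ j) x * ψ (τ j) x]
      rfl
    rw [h1, Matrix.det_permute', ← mul_assoc, ← Int.cast_mul, Int.units_coe_mul_self,
      Int.cast_one, one_mul]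
  simp only [key, Finset.sum_const, Finset.card_univ, Fintype.card_perm, nsmul_eq_mul]

/-- A weighted exponential integral of positive mass at `0` is positive everywhere. -/
theorem integral_mul_exp_pos {μ : Measure X} {ρ U : X → ℝ} (hρ : ∀ x, 0 ≤ ρ x)
    (hint : ∀ t : ℝ, Integrable (fun x => ρ x * Real.exp (t * U x)) μ)
    (hpos : 0 < ∫ x, ρ x * Real.exp (0 * U x) ∂μ) (t : ℝ) :
    0 < ∫ x, ρ x * Real.exp (t * U x) ∂μ := by
  have hnn (t : ℝ) : 0 ≤ fun x => ρ x * Real.exp (t * U x) :=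
    fun x => mul_nonneg (hρ x) (Real.exp_pos _).le
  have hsupp (t : ℝ) : Function.support (fun x => ρ x * Real.exp (t * U x)) =
      Function.support ρ := by
    ext x
    simp [Real.exp_ne_zero]
  rw [integral_pos_iff_support_of_nonneg (hnn _) (hint _), hsupp] at hpos ⊢
  exact hpos

/-- Log-convexity of a weighted exponential integral, as a consequence of Hölder's inequality. -/
theorem convexOn_log_integral_mul_exp {μ : Measure X} {ρ U : X → ℝ} (hρ : ∀ x, 0 ≤ ρ x)
    (hint : ∀ t : ℝ, Integrable (fun x => ρ x * Real.exp (t * U x)) μ)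
    (hpos : 0 < ∫ x, ρ x * Real.exp (0 * U x) ∂μ) :
    ConvexOn ℝ Set.univ fun t : ℝ => Real.log (∫ x, ρ x * Real.exp (t * U x) ∂μ) := by
  have hnn (t : ℝ) (x : X) : 0 ≤ ρ x * Real.exp (t * U x) :=
    mul_nonneg (hρ x) (Real.exp_pos _).le
  have hp := integral_mul_exp_pos hρ hint hpos
  have hmem (a t : ℝ) (ha : 0 < a) :
      MemLp (fun x => (ρ x * Real.exp (t * U x)) ^ a) (ENNReal.ofReal (1 / a)) μ := by
    have hm : AEStronglyMeasurable (fun x => (ρ x * Real.exp (t * U x)) ^ a) μ :=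
      ((hint t).aestronglyMeasurable.aemeasurable.pow_const a).aestronglyMeasurable
    rw [← integrable_norm_rpow_iff hm (by simpa using ha) ENNReal.ofReal_ne_top,
      ENNReal.toReal_ofReal (by positivity)]
    refine (hint t).congr (ae_of_all _ fun x => ?_)
    simp only
    rw [Real.norm_of_nonneg (Real.rpow_nonneg (hnn t x) a), ← Real.rpow_mul (hnn t x),
      mul_one_div_cancel ha.ne', Real.rpow_one]
  refine convexOn_iff_forall_pos.2 ⟨convex_univ, fun s _ t _ a b ha hb hab => ?_⟩
  have hpq : (1 / a).HolderConjugate (1 / b) := by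
    rw [Real.holderConjugate_iff]
    refine ⟨(one_lt_div ha).2 (by linarith), by simpa using hab⟩
  have hH := integral_mul_le_Lp_mul_Lq_of_nonneg hpq
    (ae_of_all μ fun x => Real.rpow_nonneg (hnn s x) a)
    (ae_of_all μ fun x => Real.rpow_nonneg (hnn t x) b) (hmem a s ha) (hmem b t hb)
  have hl (x : X) : (ρ x * Real.exp (s * U x)) ^ a * (ρ x * Real.exp (t * U x)) ^ b =
      ρ x * Real.exp ((a * s + b * t) * U x) := by
    rw [Real.mul_rpow (hρ x) (Real.exp_pos _).le, Real.mul_rpow (hρ x) (Real.exp_pos _).le,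
      ← Real.exp_mul, ← Real.exp_mul, mul_mul_mul_comm, ← Real.exp_add,
      ← Real.rpow_add_of_nonneg (hρ x) ha.le hb.le, hab, Real.rpow_one]
    ring_nf
  have hr (c r : ℝ) (hc : 0 < c) (x : X) :
      ((ρ x * Real.exp (r * U x)) ^ c) ^ (1 / c) = ρ x * Real.exp (r * U x) := by
    rw [← Real.rpow_mul (hnn r x), mul_one_div_cancel hc.ne', Real.rpow_one]
  simp only [hl, hr a s ha, hr b t hb, one_div_one_div] at hH
  simp only [smul_eq_mul]
  rw [← Real.log_rpow (hp s), ← Real.log_rpow (hp t),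
    ← Real.log_mul (Real.rpow_pos_of_pos (hp s) a).ne' (Real.rpow_pos_of_pos (hp t) b).ne']
  exact Real.log_le_log (hp _) hH

end Helpers

theorem continuous_mono (d : ℕ) (α : ℕ → Fin d → ℕ) (i : ℕ) : Continuous (mono d α i) := by
  unfold mono
  fun_prop

theorem UpperSemicontinuousOn.aemeasurable_restrict {X : Type*} [TopologicalSpace X]
    [MeasurableSpace X] [BorelSpace X] {w : X → ℝ} {E : Set X} (hE : MeasurableSet E)
    (hw : UpperSemicontinuousOn w E) (ν : Measure X) : AEMeasurable w (ν.restrict E) :=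
  aemeasurable_restrict_of_measurable_subtype hE
    (upperSemicontinuousOn_iff_restrict.2 hw).measurable

/-- The entries of the weighted Gram matrix are integrals of integrable functions. -/
theorem integrable_gram_entry {d : ℕ} (α : ℕ → Fin d → ℕ) {E : Set (Fin d → ℂ)}
    (hE : IsCompact E) (ν : Measure (Fin d → ℂ)) [IsProbabilityMeasure ν]
    {w : (Fin d → ℂ) → ℝ} (hw0 : ∀ z ∈ E, 0 ≤ w z) (hwbdd : ∃ M : ℝ, ∀ z ∈ E, w z ≤ M)
    (hwusc : UpperSemicontinuousOn w E) (n : ℕ) {u : (Fin d → ℂ) → ℝ} (hu : ContinuousOn u E)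
    (t : ℝ) (i j : ℕ) :
    Integrable (fun z => conj (mono d α i z) *
      (mono d α j z * ((w z * Real.exp (-t * u z) : ℝ) : ℂ) ^ (2 * n))) (ν.restrict E) := by
  obtain ⟨M, hM⟩ := hwbdd
  have hi := continuous_mono d α i
  have hj := continuous_mono d α j
  have hc : ContinuousOn (fun z => conj (mono d α i z) * mono d α j z *
      ((Real.exp (-t * u z) : ℝ) : ℂ) ^ (2 * n)) E := by
    refine ContinuousOn.mul ?_ ?_
    · exact ((Complex.continuous_conj.comp hi).mul hj).continuousOn
    · exact (Complex.continuous_ofReal.comp_continuousOn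
        (Real.continuous_exp.comp_continuousOn (continuousOn_const.mul hu))).pow _
  have hci : Integrable _ (ν.restrict E) := hc.integrableOn_compact hE
  have hwm : AEStronglyMeasurable (fun z => ((w z : ℝ) : ℂ) ^ (2 * n)) (ν.restrict E) :=
    ((Complex.measurable_ofReal.comp_aemeasurable
      (hwusc.aemeasurable_restrict hE.measurableSet ν)).pow_const _).aestronglyMeasurable
  refine (hci.mul_bdd (c := M ^ (2 * n)) hwm ?_).congr (ae_of_all _ fun z => ?_)
  · filter_upwards [ae_restrict_mem hE.measurableSet] with z hz
    rw [norm_pow, Complex.norm_real, Real.norm_of_nonneg (hw0 z hz)]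
    exact pow_le_pow_left₀ (hw0 z hz) (hM z hz) _
  · push_cast
    ring

/-- The determinant of the weighted Gram matrix as an integral of the squared modulus of the
Vandermonde determinant. -/
theorem gram_det_re_eq_integral {d : ℕ} (α : ℕ → Fin d → ℕ) {E : Set (Fin d → ℂ)}
    (hE : IsCompact E) (ν : Measure (Fin d → ℂ)) [IsProbabilityMeasure ν]
    {w : (Fin d → ℂ) → ℝ} (hw0 : ∀ z ∈ E, 0 ≤ w z) (hwbdd : ∃ M : ℝ, ∀ z ∈ E, w z ≤ M)
    (hwusc : UpperSemicontinuousOn w E) (n : ℕ) {u : (Fin d → ℂ) → ℝ} (hu : ContinuousOn u E)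
    (t : ℝ) :
    Integrable (fun ζ : Fin (mdim d n) → Fin d → ℂ =>
      Complex.normSq (vdm d (mdim d n) α ζ) * (∏ k, w (ζ k) ^ (2 * n)) *
        Real.exp (t * (-(2 * n) * ∑ k, u (ζ k)))) (Measure.pi fun _ => ν.restrict E) ∧
    ((mdim d n).factorial : ℝ) *
        (gram d n α (fun z => w z * Real.exp (-t * u z)) ν E).det.re =
      ∫ ζ : Fin (mdim d n) → Fin d → ℂ,
        Complex.normSq (vdm d (mdim d n) α ζ) * (∏ k, w (ζ k) ^ (2 * n)) *
          Real.exp (t * (-(2 * n) * ∑ k, u (ζ k))) ∂(Measure.pi fun _ => ν.restrict E) := by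
  set m := mdim d n
  let φ : Fin m → (Fin d → ℂ) → ℂ := fun i z => conj (mono d α i z)
  let ψ : Fin m → (Fin d → ℂ) → ℂ := fun j z =>
    mono d α j z * ((w z * Real.exp (-t * u z) : ℝ) : ℂ) ^ (2 * n)
  have hφψ (i j : Fin m) : Integrable (fun z => φ i z * ψ j z) (ν.restrict E) :=
    integrable_gram_entry α hE ν hw0 hwbdd hwusc n hu t i j
  have hprod (ζ : Fin m → Fin d → ℂ) : (Matrix.of fun i j => φ i (ζ j)).det *
      (Matrix.of fun i j => ψ i (ζ j)).det =
      ((Complex.normSq (vdm d m α ζ) * (∏ k, w (ζ k) ^ (2 * n)) *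
        Real.exp (t * (-(2 * n) * ∑ k, u (ζ k))) : ℝ) : ℂ) := by
    have h1 : (Matrix.of fun i j => φ i (ζ j)).det = conj (vdm d m α ζ) := by
      rw [vdm, RingHom.map_det]
      rfl
    have h2 : (Matrix.of fun i j => ψ i (ζ j)).det =
        (∏ k, ((w (ζ k) * Real.exp (-t * u (ζ k)) : ℝ) : ℂ) ^ (2 * n)) * vdm d m α ζ := by
      rw [vdm, ← Matrix.det_mul_row]
      congr 1
      ext i j
      exact mul_comm _ _
    have h3 : (∏ k, w (ζ k) ^ (2 * n)) * Real.exp (t * (-(2 * n) * ∑ k, u (ζ k))) =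
        ∏ k, (w (ζ k) * Real.exp (-t * u (ζ k))) ^ (2 * n) := by
      simp only [mul_pow, Finset.prod_mul_distrib, ← Real.exp_nat_mul, ← Real.exp_sum,
        Finset.mul_sum]
      congr 2
      refine Finset.sum_congr rfl fun k _ => ?_
      push_cast
      ring
    rw [h1, h2, mul_assoc (Complex.normSq _), h3, Complex.ofReal_mul,
      Complex.normSq_eq_conj_mul_self]
    push_cast
    ring
  have hI := integrable_det_mul_det (ν.restrict E) φ ψ hφψ
  have hA := integral_det_mul_det (ν.restrict E) φ ψ hφψ
  simp only [hprod] at hI hA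
  refine ⟨hI.re, ?_⟩
  have hG : (Matrix.of fun i j => ∫ x, φ i x * ψ j x ∂(ν.restrict E)) =
      gram d n α (fun z => w z * Real.exp (-t * u z)) ν E := by
    ext i j
    simp only [gram, Matrix.of_apply, φ, ψ, mul_assoc]
  rw [hG, integral_complex_ofReal, Fintype.card_fin] at hA
  have := congrArg Complex.re hA
  rw [Complex.ofReal_re, ← Complex.ofReal_natCast, Complex.re_ofReal_mul] at this
  exact this.symm

theorem statement13
    (d : ℕ) (hd : 1 ≤ d)
    (α : ℕ → Fin d → ℕ) (hα : Function.Bijective α)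
    (hαdeg : Monotone fun i => ∑ k, α i k)
    (E : Set (Fin d → ℂ)) (hE : IsCompact E)
    (ν : Measure (Fin d → ℂ)) [IsProbabilityMeasure ν] (hνE : ν Eᶜ = 0)
    (w : (Fin d → ℂ) → ℝ) (hw0 : ∀ z ∈ E, 0 ≤ w z)
    (hwbdd : ∃ M : ℝ, ∀ z ∈ E, w z ≤ M)
    (hwusc : UpperSemicontinuousOn w E)
    (n : ℕ)
    (hdet : 0 < (gram d n α w ν E).det.re)
    (u : (Fin d → ℂ) → ℝ) (hu : ContinuousOn u E)
    (f : ℝ → ℝ)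
    (hf : ∀ t : ℝ, f t = -(1 / (2 * (lsum d n α : ℝ))) *
      Real.log ((gram d n α (fun z => w z * Real.exp (-t * u z)) ν E).det.re)) :
    ConcaveOn ℝ Set.univ f := by
  have hrep := gram_det_re_eq_integral α hE ν hw0 hwbdd hwusc n hu
  set m := mdim d n
  let ρ : (Fin m → Fin d → ℂ) → ℝ := fun ζ =>
    Complex.normSq (vdm d m α ζ) * ∏ k, w (ζ k) ^ (2 * n)
  let U : (Fin m → Fin d → ℂ) → ℝ := fun ζ => -(2 * n) * ∑ k, u (ζ k)
  have hρ (ζ) : 0 ≤ ρ ζ := mul_nonneg (Complex.normSq_nonneg _)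
    (Finset.prod_nonneg fun k _ => (even_two_mul n).pow_nonneg _)
  have hfac : 0 < (m.factorial : ℝ) := by positivity
  have hpos : 0 < ∫ ζ, ρ ζ * Real.exp (0 * U ζ) ∂(Measure.pi fun _ => ν.restrict E) := by
    rw [← (hrep 0).2]
    simpa using mul_pos hfac hdet
  have hF := integral_mul_exp_pos hρ (fun t => (hrep t).1) hpos
  have hconv := convexOn_log_integral_mul_exp hρ (fun t => (hrep t).1) hpos
  have hf' : f = fun t => -((1 / (2 * (lsum d n α : ℝ))) •
      (Real.log (∫ ζ, ρ ζ * Real.exp (t * U ζ) ∂(Measure.pi fun _ => ν.restrict E)) +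
        -Real.log m.factorial)) := by
    funext t
    have hdt : (gram d n α (fun z => w z * Real.exp (-t * u z)) ν E).det.re ≠ 0 := by
      intro h0
      have := (hrep t).2
      rw [h0, mul_zero] at this
      exact (hF t).ne this
    rw [hf t, ← (hrep t).2, Real.log_mul hfac.ne' hdt, smul_eq_mul]
    ring
  rw [hf']
  exact ((hconv.add_const _).smul (by positivity)).neg
end

section
/- Let {f_n} be a sequence of concave functions on ℝ and let g : ℝ → ℝ. Suppose that liminf_{n→∞} f_n(t) ≥ g(t) for all t ∈ ℝ, that lim_{n→∞} f_n(0) = g(0), and that each f_n and g are differentiable at 0. Then lim_{n→∞} f_n'(0) = g'(0). -/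
open Filter

/-- A concave function on `ℝ` lies below each of its tangent lines. -/
theorem ConcaveOn.le_add_mul_of_hasDerivAt {f : ℝ → ℝ} {f' x : ℝ}
    (hf : ConcaveOn ℝ Set.univ f) (hf' : HasDerivAt f f' x) (y : ℝ) :
    f y ≤ f x + f' * (y - x) := by
  rcases lt_trichotomy x y with h | rfl | h
  · have := hf.slope_le_of_hasDerivAt (Set.mem_univ x) (Set.mem_univ y) h hf'
    rw [slope_def_field, div_le_iff₀ (sub_pos.2 h)] at this
    linarith
  · simp
  · have := hf.le_slope_of_hasDerivAt (Set.mem_univ y) (Set.mem_univ x) h hf'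
    rw [slope_def_field, le_div_iff₀ (sub_pos.2 h)] at this
    linarith

theorem statement14
    (f : ℕ → ℝ → ℝ) (g : ℝ → ℝ)
    (hconc : ∀ n, ConcaveOn ℝ Set.univ (f n))
    (hliminf : ∀ t : ℝ, ∀ ε > (0 : ℝ), ∀ᶠ n in atTop, g t - ε ≤ f n t)
    (hlim0 : Tendsto (fun n => f n 0) atTop (nhds (g 0)))
    (f' : ℕ → ℝ) (hf' : ∀ n, HasDerivAt (f n) (f' n) 0)
    (g' : ℝ) (hg' : HasDerivAt g g' 0) :
    Tendsto f' atTop (nhds g') := by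
  have key : ∀ ε > (0 : ℝ), ∃ δ > (0 : ℝ), ∀ t : ℝ, |t| ≤ δ → t ≠ 0 →
      ∀ᶠ n in atTop, (g' - f' n) * t < ε * |t| := by
    intro ε hε
    have hlittle := (hasDerivAt_iff_isLittleO.1 hg').def (half_pos hε)
    obtain ⟨δ, hδ, hball⟩ := Metric.eventually_nhds_iff.1 hlittle
    refine ⟨δ / 2, half_pos hδ, fun t ht ht0 => ?_⟩
    have hpos : 0 < |t| := abs_pos.2 ht0
    have hgt := hball (y := t) (by rw [Real.dist_eq, sub_zero]; linarith)
    simp only [sub_zero, smul_eq_mul, Real.norm_eq_abs] at hgt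
    have hη : 0 < ε * |t| / 8 := by positivity
    filter_upwards [hliminf t _ hη, hlim0.eventually_lt_const (lt_add_of_pos_right (g 0) hη)]
      with n hn hn0
    have htan := (hconc n).le_add_mul_of_hasDerivAt (hf' n) t
    rw [sub_zero] at htan
    have := (abs_le.1 hgt).1
    nlinarith
  rw [Metric.tendsto_nhds]
  intro ε hε
  obtain ⟨δ, hδ, h⟩ := key ε hε
  filter_upwards [h δ (abs_of_pos hδ).le hδ.ne',
    h (-δ) (by rw [abs_neg, abs_of_pos hδ]) (neg_ne_zero.2 hδ.ne')] with n h₁ h₂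
  rw [abs_neg] at h₂
  rw [abs_of_pos hδ] at h₁ h₂
  rw [Real.dist_eq, abs_lt]
  constructor
  · linarith [lt_of_mul_lt_mul_right h₁ hδ.le]
  · have : (f' n - g') * δ < ε * δ := by linarith
    exact lt_of_mul_lt_mul_right this hδ.le
end
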